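/- arXiv:2402.11918 — 4 statements merged into one kernel-verified Lean document; each statement's English description precedes it below -/
import Mathlib

section
/- Let X be a subset of H. Then for every doctor d ∈ D, every integer t with 0 ≤ t ≤ k_X, and every pair of edges e ∈ R_{X,t}(d) \ E(X) and f ∈ E(d) \ R_{X,t}, one has e ≿_d f. -/
open Set

/-- `incid v e` : edge `e` is incident to vertex `v`. -/
def incid {V : Type*} (v : V) (e : V × V) : Prop := e.1 = v ∨ e.2 = v

/-- An instance of the super-stable matching problem with ties: a finite simple
bipartite graph whose vertices are partitioned into doctors `Dset` and
hospitals `Hset`, each edge `(d,h)` joining a doctor to a hospital, together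
with, for each vertex `v`, a transitive and total preference relation
`pref v` (possibly with ties) on the edges incident to `v`. -/
structure SMInstance (V : Type*) where
  Dset : Set V
  Hset : Set V
  E : Set (V × V)
  pref : V → (V × V) → (V × V) → Prop
  disj : Disjoint Dset Hset
  cover : Dset ∪ Hset = Set.univ
  edge_mem : ∀ e ∈ E, e.1 ∈ Dset ∧ e.2 ∈ Hset
  pref_total : ∀ v, ∀ e ∈ E, ∀ f ∈ E, incid v e → incid v f →
    pref v e f ∨ pref v f e
  pref_trans : ∀ v, ∀ e ∈ E, ∀ f ∈ E, ∀ g ∈ E,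
    incid v e → incid v f → incid v g →
    pref v e f → pref v f g → pref v e g

namespace SMInstance

variable {V : Type*} (I : SMInstance V)

/-- Strict preference `e ≻_v f`. -/
def sprefer (v : V) (e f : V × V) : Prop := I.pref v e f ∧ ¬ I.pref v f e

/-- `Ch_d(F)` for a doctor `d`. -/
def Chd (d : V) (F : Set (V × V)) : Set (V × V) :=
  {e ∈ F | incid d e ∧ ∀ f ∈ F, incid d f → I.pref d e f}

/-- `Ch_h(F)` for a hospital `h`. -/
def Chh (h : V) (F : Set (V × V)) : Set (V × V) :=
  {e ∈ F | incid h e ∧ ∀ f ∈ F, incid h f → f ≠ e → I.sprefer h e f}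

/-- `Ch_D(F) = ⋃_{d ∈ D} Ch_d(F)`. -/
def ChD (F : Set (V × V)) : Set (V × V) := ⋃ d ∈ I.Dset, I.Chd d F

/-- `Ch_H(F) = ⋃_{h ∈ H} Ch_h(F)`. -/
def ChH (F : Set (V × V)) : Set (V × V) := ⋃ h ∈ I.Hset, I.Chh h F

/-- `D[F]` : the set of doctors incident to some edge of `F`. -/
def docs (F : Set (V × V)) : Set V := {d ∈ I.Dset | ∃ e ∈ F, incid d e}

/-- The sequence `R_{X,t}` of the preprocessing algorithm:
`R_{X,0} = E(X)`, and `R_{X,t+1} = R_{X,t} ∪ (P_{X,t+1} \ Q_{X,t+1})` where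
`P_{X,t+1} = Ch_D(E \ R_{X,t})` and
`Q_{X,t+1} = Ch_H(P_{X,t+1} ∪ R_{X,t}) ∩ P_{X,t+1}`. -/
def R (X : Set V) : ℕ → Set (V × V)
  | 0 => {e ∈ I.E | e.2 ∈ X}
  | t + 1 =>
      R X t ∪
        (I.ChD (I.E \ R X t) \
          (I.ChH (I.ChD (I.E \ R X t) ∪ R X t) ∩ I.ChD (I.E \ R X t)))

/-- `k_X` : the least `t ≥ 1` with `R_{X,t} = R_{X,t-1}`. -/
noncomputable def kX (X : Set V) : ℕ :=
  sInf {t : ℕ | 1 ≤ t ∧ I.R X t = I.R X (t - 1)}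

/-- `B_X = R_{X,k_X}`. -/
noncomputable def B (X : Set V) : Set (V × V) := I.R X (I.kX X)

/-- A matching in the induced subgraph `G⟨V \ X⟩`. -/
def isMatching (X : Set V) (μ : Set (V × V)) : Prop :=
  μ ⊆ I.E ∧ (∀ e ∈ μ, e.1 ∉ X ∧ e.2 ∉ X) ∧
    ∀ v, ∀ e ∈ μ, ∀ f ∈ μ, incid v e → incid v f → e = f

/-- `e = (d,h)` blocks the matching `μ` of `G⟨V \ X⟩`:
`e ∈ E⟨V \ X⟩ \ μ`, `e ≿_d μ(d)` and `e ≿_h μ(h)`. -/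
def blocks (X : Set V) (μ : Set (V × V)) (e : V × V) : Prop :=
  e ∈ I.E ∧ e.1 ∉ X ∧ e.2 ∉ X ∧ e ∉ μ ∧
    (∀ f ∈ μ, incid e.1 f → I.pref e.1 e f) ∧
    (∀ f ∈ μ, incid e.2 f → I.pref e.2 e f)

/-- `μ` is a super-stable matching in `G⟨V \ X⟩`. -/
def superStable (X : Set V) (μ : Set (V × V)) : Prop :=
  I.isMatching X μ ∧ ∀ e, ¬ I.blocks X μ e

/-- `X` is feasible: `G⟨V \ X⟩` admits a super-stable matching. -/
def feasible (X : Set V) : Prop := ∃ μ, I.superStable X μ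

/-- `h` is a critical hospital with respect to `(B_X, μ_X)`:
`μ_X(h) = ∅` and at least one of `B_X(h) ≠ ∅` and
`Ch_D(E \ B_X) ∩ E(h) ≠ ∅` holds. -/
def critical (X : Set V) (μ : Set (V × V)) (h : V) : Prop :=
  h ∈ I.Hset ∧ (∀ e ∈ μ, ¬ incid h e) ∧
    ((∃ e ∈ I.B X, incid h e) ∨ ∃ e ∈ I.ChD (I.E \ I.B X), incid h e)

end SMInstance

namespace SMInstance

/-- The only doctor incident to an edge is its first endpoint. -/
theorem fst_eq_of_incid {V : Type*} (I : SMInstance V) {d : V} (hd : d ∈ I.Dset)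
    {e : V × V} (he : e ∈ I.E) (hed : incid d e) : e.1 = d := by
  rcases hed with h | h
  · exact h
  · exact absurd (h ▸ (I.edge_mem e he).2) (Set.disjoint_left.mp I.disj hd)

/-- A doctor weakly prefers each of its chosen edges to every available edge. -/
theorem pref_of_mem_ChD {V : Type*} (I : SMInstance V) {F : Set (V × V)} (hF : F ⊆ I.E)
    {d : V} (hd : d ∈ I.Dset) {e f : V × V} (he : e ∈ I.ChD F) (hed : incid d e)
    (hf : f ∈ F) (hfd : incid d f) : I.pref d e f := by
  obtain ⟨d', hd', heF, hed', hpref⟩ := Set.mem_iUnion₂.mp he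
  obtain rfl : d' = d :=
    (I.fst_eq_of_incid hd' (hF heF) hed').symm.trans (I.fst_eq_of_incid hd (hF heF) hed)
  exact hpref f hf hfd

end SMInstance

/-- Let `X ⊆ H`. For every doctor `d ∈ D`, every `t` with `0 ≤ t ≤ k_X`, and
every pair of edges `e ∈ R_{X,t}(d) \ E(X)` and `f ∈ E(d) \ R_{X,t}`, we have
`e ≿_d f`. -/
theorem statement1 {V : Type*} [Fintype V] (I : SMInstance V)
    (X : Set V) (hX : X ⊆ I.Hset) (d : V) (hd : d ∈ I.Dset)
    (t : ℕ) (ht : t ≤ I.kX X)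
    (e : V × V) (he : e ∈ I.R X t) (hed : incid d e) (heX : e.2 ∉ X)
    (f : V × V) (hf : f ∈ I.E) (hfd : incid d f) (hfR : f ∉ I.R X t) :
    I.pref d e f := by
  clear ht
  induction t with
  | zero => exact absurd he.2 heX
  | succ t ih =>
    have hfR' : f ∉ I.R X t := fun h => hfR (Or.inl h)
    rcases he with he | he
    · exact ih he hfR'
    · exact I.pref_of_mem_ChD Set.sdiff_subset hd he.1 hed ⟨hf, hfR'⟩ hfd
end

section
/- Let X be a subset of H. Then for every hospital h ∈ H, the set Ch_D(E \ B_X) contains at most one edge incident to h. -/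
open Set

namespace SMInstance

variable {V : Type*} (I : SMInstance V)

theorem R_monotone (X : Set V) : Monotone (I.R X) :=
  monotone_nat_of_le_succ fun _ => subset_union_left

theorem R_kX_eq [Finite V] (X : Set V) :
    1 ≤ I.kX X ∧ I.R X (I.kX X) = I.R X (I.kX X - 1) := by
  have hne : {t : ℕ | 1 ≤ t ∧ I.R X t = I.R X (t - 1)}.Nonempty := by
    obtain ⟨n, hn⟩ := WellFoundedGT.monotone_chain_condition ⟨I.R X, I.R_monotone X⟩
    exact ⟨n + 1, by omega, (hn (n + 1) (by omega)).symm⟩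
  exact Nat.sInf_mem hne

theorem ChD_subset (F : Set (V × V)) : I.ChD F ⊆ F :=
  iUnion₂_subset fun _ _ _ he => he.1

/-- At termination, no edge proposed by the doctors is rejected by the hospitals. -/
theorem ChD_diff_B_subset_ChH [Finite V] (X : Set V) :
    I.ChD (I.E \ I.B X) ⊆ I.ChH (I.ChD (I.E \ I.B X) ∪ I.B X) := by
  obtain ⟨hk, heq⟩ := I.R_kX_eq X
  have hB : I.B X = I.R X (I.kX X - 1) := heq
  have hfix : I.R X (I.kX X - 1 + 1) = I.B X := by rw [Nat.sub_add_cancel hk]; rfl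
  intro e he
  by_contra hcon
  refine (I.ChD_subset _ he).2 ?_
  rw [← hfix, R, ← hB]
  exact Or.inr ⟨he, fun hq => hcon hq.1⟩

/-- An edge of the graph is incident to only one hospital. -/
theorem eq_snd_of_incid {e : V × V} (he : e ∈ I.E) {h : V} (hh : h ∈ I.Hset)
    (hi : incid h e) : e.2 = h := by
  rcases hi with rfl | hi
  · exact (disjoint_left.1 I.disj (I.edge_mem e he).1 hh).elim
  · exact hi

theorem sprefer_of_mem_ChH {F : Set (V × V)} {h : V} (hh : h ∈ I.Hset) {e f : V × V}
    (heE : e ∈ I.E) (he : e ∈ I.ChH F) (hf : f ∈ F) (hie : incid h e) (hif : incid h f)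
    (hne : f ≠ e) : I.sprefer h e f := by
  simp only [ChH, mem_iUnion] at he
  obtain ⟨h', hh', -, hie', hbest⟩ := he
  obtain rfl : h' = h :=
    (I.eq_snd_of_incid heE hh' hie').symm.trans (I.eq_snd_of_incid heE hh hie)
  exact hbest f hf hif hne

end SMInstance

/-- Let `X ⊆ H`. Then for every hospital `h ∈ H`, the set `Ch_D(E \ B_X)`
contains at most one edge incident to `h`. -/
theorem statement2 {V : Type*} [Fintype V] (I : SMInstance V)
    (X : Set V) (hX : X ⊆ I.Hset) (h : V) (hh : h ∈ I.Hset) :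
    ∀ e ∈ I.ChD (I.E \ I.B X), ∀ f ∈ I.ChD (I.E \ I.B X),
      incid h e → incid h f → e = f := by
  intro e he f hf hie hif
  by_contra hne
  have hef := I.sprefer_of_mem_ChH hh (I.ChD_subset _ he).1 (I.ChD_diff_B_subset_ChH X he)
    (Or.inl hf) hie hif (Ne.symm hne)
  have hfe := I.sprefer_of_mem_ChH hh (I.ChD_subset _ hf).1 (I.ChD_diff_B_subset_ChH X hf)
    (Or.inl he) hif hie hne
  exact hef.2 hfe.1
end

section
/- Let X be a subset of H and let k = max{k_∅, k_X}. Extend the sequences constantly after stabilization, i.e., for a symbol Z ∈ {∅, X} and t with k_Z < t ≤ k, set R_{Z,t} = R_{Z,k_Z}. Then R_{∅,t} ⊆ R_{X,t} for every integer t with 0 ≤ t ≤ k. -/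
open Set

namespace SMInstance

variable {V : Type*} (I : SMInstance V)

theorem mem_ChD_of_subset {F G : Set (V × V)} (h : F ⊆ G) {e : V × V}
    (he : e ∈ I.ChD G) (heF : e ∈ F) : e ∈ I.ChD F := by
  simp only [ChD, Chd, Set.mem_iUnion, Set.mem_ofPred_eq] at he ⊢
  obtain ⟨d, hd, -, hinc, hbest⟩ := he
  exact ⟨d, hd, heF, hinc, fun f hf => hbest f (h hf)⟩

theorem mem_ChH_of_subset {F G : Set (V × V)} (h : F ⊆ G) {e : V × V}
    (he : e ∈ I.ChH G) (heF : e ∈ F) : e ∈ I.ChH F := by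
  simp only [ChH, Chh, Set.mem_iUnion, Set.mem_ofPred_eq] at he ⊢
  obtain ⟨v, hv, -, hinc, hbest⟩ := he
  exact ⟨v, hv, heF, hinc, fun f hf => hbest f (h hf)⟩

theorem ChD_diff_union_subset {A B : Set (V × V)} (h : A ⊆ B) :
    I.ChD (I.E \ A) ∪ A ⊆ I.ChD (I.E \ B) ∪ B := by
  rintro e (he | he)
  · by_cases heB : e ∈ B
    · exact Or.inr heB
    · exact Or.inl (I.mem_ChD_of_subset (Set.sdiff_subset_sdiff_right h) he
        ⟨(I.ChD_subset _ he).1, heB⟩)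
  · exact Or.inr (h he)

theorem R_mono {X Y : Set V} (h : X ⊆ Y) (t : ℕ) : I.R X t ⊆ I.R Y t := by
  induction t with
  | zero => exact fun e he => ⟨he.1, h he.2⟩
  | succ t ih =>
    have hsub := I.ChD_diff_union_subset ih
    rintro e (he | ⟨hP, hQ⟩)
    · exact Or.inl (ih he)
    · rcases hsub (Or.inl hP) with hP' | hR
      · exact Or.inr ⟨hP', fun hQ' =>
          hQ ⟨I.mem_ChH_of_subset hsub hQ'.1 (Or.inl hP), hP⟩⟩
      · exact Or.inl hR

end SMInstance

/-- Let `X ⊆ H` and `k = max {k_∅, k_X}` (the sequences being extended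
constantly after stabilization). Then `R_{∅,t} ⊆ R_{X,t}` for every `t` with
`0 ≤ t ≤ k`. -/
theorem statement5 {V : Type*} [Fintype V] (I : SMInstance V)
    (X : Set V) (hX : X ⊆ I.Hset) :
    ∀ t ≤ max (I.kX (∅ : Set V)) (I.kX X), I.R ∅ t ⊆ I.R X t :=
  fun t _ => I.R_mono (Set.empty_subset X) t
end

section
/- Let X ∈ F_H and let σ be a super-stable matching in G⟨V \ X⟩. Then for every hospital h ∈ S_∅ \ X, we have σ(h) ≠ ∅, i.e., σ matches h. -/
open Set

namespace SMInstance

variable {V : Type*} {I : SMInstance V}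

/-- An edge chosen by the doctors is weakly best, for its doctor, among the available edges. -/
lemma mem_ChD {F : Set (V × V)} (hF : F ⊆ I.E) {e : V × V} (he : e ∈ I.ChD F) :
    e ∈ F ∧ ∀ f ∈ F, incid e.1 f → I.pref e.1 e f := by
  simp only [ChD, mem_iUnion] at he
  obtain ⟨d, hd, heF, hinc, hbest⟩ := he
  rcases hinc with rfl | rfl
  · exact ⟨heF, hbest⟩
  · exact (Set.disjoint_left.mp I.disj hd (I.edge_mem e (hF heF)).2).elim

/-- If an edge set `σ` avoids `R ∅ t`, then every edge in `R ∅ t` or currently proposed is weakly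
preferred by its doctor to the edges of `σ`. -/
lemma pref_of_mem_R_union_ChD {σ : Set (V × V)} (hσE : σ ⊆ I.E) {t : ℕ}
    (hdisj : Disjoint σ (I.R ∅ t)) {f : V × V}
    (hf : f ∈ I.R ∅ t ∪ I.ChD (I.E \ I.R ∅ t)) :
    f ∈ I.E ∧ ∀ g ∈ σ, incid f.1 g → I.pref f.1 f g := by
  have proposed : ∀ s, Disjoint σ (I.R ∅ s) → f ∈ I.ChD (I.E \ I.R ∅ s) →
      f ∈ I.E ∧ ∀ g ∈ σ, incid f.1 g → I.pref f.1 f g := fun s hs hfs =>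
    have hmem := mem_ChD sdiff_subset hfs
    ⟨hmem.1.1, fun g hg => hmem.2 g ⟨hσE hg, Set.disjoint_left.mp hs hg⟩⟩
  rcases hf with hf | hf
  · induction t with
    | zero => simp [R] at hf
    | succ t ih =>
      have ht : Disjoint σ (I.R ∅ t) := hdisj.mono_right subset_union_left
      rcases hf with hf | hf
      · exact ih ht hf
      · exact proposed t ht hf.1
  · exact proposed t hdisj hf

/-- No edge of a super-stable matching of `G⟨V \ X⟩` with `X ⊆ H` is ever rejected. -/
lemma disjoint_R {X : Set V} (hX : X ⊆ I.Hset) {σ : Set (V × V)} (hσ : I.superStable X σ)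
    (t : ℕ) : Disjoint σ (I.R ∅ t) := by
  obtain ⟨⟨hσE, hσX, hσm⟩, hnb⟩ := hσ
  induction t with
  | zero => simp [R]
  | succ t ih =>
    rw [Set.disjoint_left]
    rintro e heσ (heR | ⟨heP, heQ⟩)
    · exact Set.disjoint_left.mp ih heσ heR
    have heH := (I.edge_mem e (hσE heσ)).2
    have hnot : e ∉ I.Chh e.2 (I.ChD (I.E \ I.R ∅ t) ∪ I.R ∅ t) := fun hc =>
      heQ ⟨mem_biUnion heH hc, heP⟩
    obtain ⟨f, hf, hinc, hne, hns⟩ : ∃ f ∈ I.ChD (I.E \ I.R ∅ t) ∪ I.R ∅ t,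
        incid e.2 f ∧ f ≠ e ∧ ¬ I.sprefer e.2 e f := by
      by_contra! hcon
      exact hnot ⟨Or.inl heP, Or.inr rfl, hcon⟩
    obtain ⟨hfE, hfd⟩ := pref_of_mem_R_union_ChD hσE ih (Or.symm hf)
    obtain ⟨hfD, hfH⟩ := I.edge_mem f hfE
    have hfe : f.2 = e.2 := hinc.resolve_left fun h1 =>
      Set.disjoint_left.mp I.disj hfD (h1 ▸ heH)
    have hpref : I.pref e.2 f e := by
      rcases I.pref_total e.2 f hfE e (hσE heσ) hinc (Or.inr rfl) with hp | hp
      · exact hp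
      · by_contra hnp
        exact hns ⟨hp, hnp⟩
    refine hnb f ⟨hfE, fun h1 => Set.disjoint_left.mp I.disj hfD (hX h1),
      hfe ▸ (hσX e heσ).2, fun hfσ => hne (hσm e.2 f hfσ e heσ hinc (Or.inr rfl)), hfd, ?_⟩
    intro g hg hgi
    rw [hfe] at hgi ⊢
    rwa [hσm e.2 g hg e heσ hgi (Or.inr rfl)]

end SMInstance

/-- Let `X ∈ F_H` and let `σ` be a super-stable matching in `G⟨V \ X⟩`.
Then for every hospital `h ∈ S_∅ \ X`, we have `σ(h) ≠ ∅`, i.e. `σ`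
matches `h`. -/
theorem statement9 {V : Type*} [Fintype V] (I : SMInstance V)
    (μ0 : Set (V × V)) (hμ0 : I.isMatching (∅ : Set V) μ0)
    (hμ0Ch : μ0 ⊆ I.ChD (I.E \ I.B (∅ : Set V)))
    (hμ0cov : ∀ d ∈ I.docs (I.E \ I.B (∅ : Set V)), ∃ e ∈ μ0, incid d e)
    (X : Set V) (hX : X ⊆ I.Hset)
    (σ : Set (V × V)) (hσ : I.superStable X σ)
    (h : V) (hcrit : I.critical (∅ : Set V) μ0 h) (hhX : h ∉ X) :
    ∃ e ∈ σ, incid h e := by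
  by_contra! hun
  obtain ⟨hH, -, hex⟩ := hcrit
  have hdisj := SMInstance.disjoint_R hX hσ (I.kX ∅)
  obtain ⟨f, hf, hinc⟩ : ∃ f ∈ I.B ∅ ∪ I.ChD (I.E \ I.B ∅), incid h f := by
    rcases hex with ⟨f, hf, hi⟩ | ⟨f, hf, hi⟩
    · exact ⟨f, Or.inl hf, hi⟩
    · exact ⟨f, Or.inr hf, hi⟩
  obtain ⟨hfE, hfd⟩ := SMInstance.pref_of_mem_R_union_ChD hσ.1.1 hdisj hf
  obtain ⟨hfD, hfH⟩ := I.edge_mem f hfE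
  have hfh : f.2 = h := hinc.resolve_left fun h1 =>
    Set.disjoint_left.mp I.disj hfD (h1 ▸ hH)
  subst hfh
  exact hσ.2 f ⟨hfE, fun h1 => Set.disjoint_left.mp I.disj hfD (hX h1), hhX,
    fun hfσ => hun f hfσ hinc, hfd, fun g hg hgi => (hun g hg hgi).elim⟩
end
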